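/- arXiv:1102.4027 — 2 statements merged into one kernel-verified Lean document; each statement's English description precedes it below -/
import Mathlib

section
/- Let V be an affine subspace of M_n(K), n ≥ 1, consisting entirely of invertible matrices. Then the dimension of V is at most n(n-1)/2. -/
open Matrix

/-- If every row is nonzero, there is a nonempty index set on which row sums do not vanish. -/
lemma aux_set {K : Type*} [Field K] {n : ℕ} (P : Matrix (Fin (n+1)) (Fin (n+1)) K)
    (hP : ∀ i, ∃ j, P i j ≠ 0) :
    ∃ I : Finset (Fin (n+1)), I.Nonempty ∧ ∀ i ∈ I, ∑ j ∈ I, P i j ≠ 0 := by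
  classical
  let Q : Finset (Fin (n+1)) → Prop := fun I => I.Nonempty ∧ ∀ i ∈ I, ∃ j ∈ I, P i j ≠ 0
  have hQ : ∃ I, Q I := ⟨Finset.univ, Finset.univ_nonempty, fun i _ => by
    obtain ⟨j, hj⟩ := hP i
    exact ⟨j, Finset.mem_univ _, hj⟩⟩
  obtain ⟨I, hI, hmin⟩ : ∃ I, Q I ∧ ∀ J, Q J → I.card ≤ J.card := by
    obtain ⟨I, hI, hm⟩ := Set.exists_min_image {I | Q I} Finset.card (Set.toFinite _) hQ
    exact ⟨I, hI, hm⟩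
  refine ⟨I, hI.1, ?_⟩
  -- any choice function on I is injective on I
  have inj : ∀ f : Fin (n+1) → Fin (n+1), (∀ i ∈ I, f i ∈ I ∧ P i (f i) ≠ 0) →
      Set.InjOn f I := by
    intro f hf
    have : Q (I.image f) := by
      refine ⟨hI.1.image f, ?_⟩
      intro j hj
      obtain ⟨i, hi, rfl⟩ := Finset.mem_image.1 hj
      exact ⟨f (f i), Finset.mem_image_of_mem _ (hf i hi).1, (hf _ (hf i hi).1).2⟩
    exact Finset.card_image_iff.1 (le_antisymm Finset.card_image_le (hmin _ this))
  have hex : ∀ i, ∃ j, i ∈ I → j ∈ I ∧ P i j ≠ 0 := by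
    intro i
    by_cases hi : i ∈ I
    · obtain ⟨j, hj⟩ := hI.2 i hi
      exact ⟨j, fun _ => hj⟩
    · exact ⟨i, fun h => absurd h hi⟩
  choose f hf using hex
  intro i hi
  rw [Finset.sum_eq_single (f i)]
  · exact (hf i hi).2
  · intro j hj hne
    by_contra hPj
    have h1 := inj f hf
    have hsurj := Finset.surj_on_of_inj_on_of_card_le (s := I) (t := I) (fun a _ => f a)
      (fun a ha => (hf a ha).1) (fun a b ha hb hab => h1 ha hb hab) le_rfl j hj
    obtain ⟨k, hk, hkj⟩ := hsurj
    have hki : k ≠ i := by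
      rintro rfl
      exact hne hkj
    have h2 := inj (Function.update f i j) (by
      intro a ha
      by_cases hai : a = i
      · subst hai
        simpa using ⟨hj, hPj⟩
      · simpa [Function.update_of_ne hai] using hf a ha)
    exact hki (h2 hk hi (by simp [Function.update_of_ne hki, ← hkj]))
  · intro h
    exact absurd (hf i hi).1 h

lemma aux_adapted {K : Type*} [Field K] {n : ℕ}
    (S : Submodule K (Matrix (Fin (n+1)) (Fin (n+1)) K))
    (h : ∀ B ∈ S, IsUnit (1 + B)) :
    ∃ i, ∀ M ∈ S, (∀ r c, r ≠ i → M r c = 0) → M = 0 := by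
  classical
  by_contra! hcon
  choose M hMS hM0 hMne using hcon
  let P : Matrix (Fin (n+1)) (Fin (n+1)) K := fun i j => M i i j
  obtain ⟨I, ⟨i0, hi0⟩, hI⟩ := aux_set P (by
    intro i
    by_contra! hz
    apply hMne i
    ext r c
    by_cases hr : r = i
    · subst hr
      exact hz c
    · exact hM0 i r c hr)
  let c : Fin (n+1) → K := fun i => if i ∈ I then -(∑ j ∈ I, P i j)⁻¹ else 0
  let v : Fin (n+1) → K := fun i => if i ∈ I then 1 else 0
  let B := ∑ i, c i • M i
  have hB : B ∈ S := Submodule.sum_mem _ fun i _ => S.smul_mem _ (hMS i)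
  have hBe : ∀ r s, B r s = c r * P r s := by
    intro r s
    simp only [B, Matrix.sum_apply, Matrix.smul_apply, smul_eq_mul]
    rw [Finset.sum_eq_single r]
    · intro b _ hb
      rw [hM0 b r s hb.symm, mul_zero]
    · simp
  have hv : (1 + B) *ᵥ v = 0 := by
    rw [Matrix.add_mulVec, Matrix.one_mulVec]
    ext r
    have : (B *ᵥ v) r = c r * ∑ j ∈ I, P r j := by
      simp [Matrix.mulVec, dotProduct, hBe, v, Finset.mul_sum]
    rw [Pi.add_apply, this]
    by_cases hr : r ∈ I
    · simp [v, c, hr, hI r hr]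
    · simp [v, c, hr]
  have hv0 : v = 0 :=
    Matrix.mulVec_injective_of_isUnit (h B hB) (by simpa using hv)
  have := congrFun hv0 i0
  simp [v, hi0] at this

lemma aux_main {K : Type*} [Field K] : ∀ (n : ℕ)
    (S : Submodule K (Matrix (Fin n) (Fin n) K))
    (_ : ∀ B ∈ S, IsUnit (1 + B)), 2 * Module.finrank K S ≤ n * (n - 1) := by
  intro n
  induction n with
  | zero =>
    intro S _
    have : Module.finrank K S = 0 := Module.finrank_zero_of_subsingleton
    simp [this]
  | succ n ih =>
    intro S h
    obtain ⟨i, hi⟩ := aux_adapted S h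
    let φ : Matrix (Fin (n+1)) (Fin (n+1)) K →ₗ[K] (Fin n → K) :=
      { toFun := fun M r => M (i.succAbove r) i
        map_add' := fun _ _ => rfl
        map_smul' := fun _ _ => rfl }
    let ψ : Matrix (Fin (n+1)) (Fin (n+1)) K →ₗ[K] Matrix (Fin n) (Fin n) K :=
      { toFun := fun M => M.submatrix i.succAbove i.succAbove
        map_add' := fun _ _ => rfl
        map_smul' := fun _ _ => rfl }
    let φ' := φ.comp S.subtype
    let ψ' := (ψ.comp S.subtype).comp (LinearMap.ker φ').subtype
    have hcol : ∀ M : LinearMap.ker φ', ∀ r, r ≠ i → (M : S).1 r i = 0 := by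
      intro M r hr
      obtain ⟨r, rfl⟩ := Fin.exists_succAbove_eq hr
      exact congrFun (LinearMap.mem_ker.1 M.2) r
    have hinj : Function.Injective ψ' := by
      intro M N hMN
      apply Subtype.ext
      apply Subtype.ext
      apply sub_eq_zero.1
      apply hi _ (S.sub_mem (M : S).2 (N : S).2)
      intro r c hr
      rw [Matrix.sub_apply, sub_eq_zero]
      by_cases hc : c = i
      · subst hc
        rw [hcol M r hr, hcol N r hr]
      · obtain ⟨r, rfl⟩ := Fin.exists_succAbove_eq hr
        obtain ⟨c, rfl⟩ := Fin.exists_succAbove_eq hc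
        exact congrFun (congrFun hMN r) c
    have h1 := LinearMap.finrank_range_add_finrank_ker φ'
    have h2 : Module.finrank K (LinearMap.range φ') ≤ n := by
      simpa using Submodule.finrank_le (LinearMap.range φ')
    have h3 := LinearMap.finrank_range_of_inj hinj
    have h4 := ih (LinearMap.range ψ') (by
      rintro _ ⟨M, rfl⟩
      have hu := h _ (M : S).2
      rw [Matrix.isUnit_iff_isUnit_det, isUnit_iff_ne_zero] at hu ⊢
      intro hz
      apply hu
      rw [Matrix.det_succ_column _ i, Finset.sum_eq_single i]
      · have : ((1 + (M : S).1).submatrix i.succAbove i.succAbove) = 1 + ψ' M := by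
          rw [Matrix.submatrix_add, Pi.add_apply, Pi.add_apply,
            Matrix.submatrix_one _ Fin.succAbove_right_injective]
          rfl
        rw [this, hz, mul_zero]
      · intro r _ hr
        simp [hcol M r hr, Matrix.one_apply_ne hr]
      · simp)
    rcases n with _ | m
    · omega
    · simp only [Nat.add_sub_cancel] at *
      nlinarith

theorem stmt_4 {K : Type*} [Field K] {n : ℕ} (hn : 1 ≤ n)
    (A : Matrix (Fin n) (Fin n) K)
    (S : Submodule K (Matrix (Fin n) (Fin n) K))
    (h : ∀ B ∈ S, IsUnit (A + B)) :
    Module.finrank K S ≤ n * (n - 1) / 2 := by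
  have hA : IsUnit A := by simpa using h 0 S.zero_mem
  obtain ⟨u, rfl⟩ := hA
  let L := LinearMap.mulLeft K (↑u⁻¹ : Matrix (Fin n) (Fin n) K)
  have hL : Function.Injective L := by
    intro x y hxy
    exact (Units.mul_right_inj u⁻¹).1 hxy
  have h1 := aux_main n (S.map L) (by
    rintro _ ⟨B, hB, rfl⟩
    have : 1 + L B = (↑u⁻¹ : Matrix (Fin n) (Fin n) K) * (↑u + B) := by
      simp only [L, LinearMap.mulLeft_apply, mul_add, Units.inv_mul]
    rw [this]
    exact u⁻¹.isUnit.mul (h B hB))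
  have h2 : Module.finrank K (S.map L) = Module.finrank K S :=
    (Submodule.equivMapOfInjective L hL S).finrank_eq.symm
  omega
end

section
/- Let n, p, r be positive integers with r ≤ min(n,p), and let V be an affine subspace of M_{n,p}(K) all of whose elements have rank at least r. Then the codimension of V in M_{n,p}(K) is at least r(r+1)/2. -/
open Matrix

/-- Combinatorial lemma: if every row of a square matrix is nonzero then some nonzero vector `v`
satisfies `(Φ v)_i ≠ 0` whenever `v_i ≠ 0`. -/
lemma exists_good_vec {K : Type*} [Field K] {n : ℕ}
    (Φ : Fin (n+1) → Fin (n+1) → K) (hΦ : ∀ i, ∃ j, Φ i j ≠ 0) :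
    ∃ v : Fin (n+1) → K, v ≠ 0 ∧ ∀ i, v i ≠ 0 → ∑ j, Φ i j * v j ≠ 0 := by
  classical
  let P : Finset (Fin (n+1)) → Prop := fun I => I.Nonempty ∧ ∀ i ∈ I, ∃ j ∈ I, Φ i j ≠ 0
  have hex : ∃ I, P I := ⟨Finset.univ, Finset.univ_nonempty, fun i _ => by
    obtain ⟨j, hj⟩ := hΦ i
    exact ⟨j, Finset.mem_univ _, hj⟩⟩
  obtain ⟨I, hI, hmin⟩ := exists_minimal_of_wellFoundedLT P hex
  have key : ∀ j ∈ I, ∃ i ∈ I, ∀ k ∈ I, Φ i k ≠ 0 → k = j := by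
    intro j hj
    by_contra hcon
    push Not at hcon
    have hP : P (I.erase j) := by
      refine ⟨?_, ?_⟩
      · obtain ⟨k, hk, _, hkj⟩ := hcon j hj
        exact ⟨k, Finset.mem_erase.2 ⟨hkj, hk⟩⟩
      · intro i hi
        obtain ⟨k, hk, h1, hkj⟩ := hcon i (Finset.mem_of_mem_erase hi)
        exact ⟨k, Finset.mem_erase.2 ⟨hkj, hk⟩, h1⟩
    have := hmin hP (Finset.erase_subset j I) hj
    simp at this
  choose! g hgI hg using key
  have ginj : Set.InjOn g I := by
    intro a ha b hb hab
    obtain ⟨k, hk, hk0⟩ := hI.2 (g a) (hgI a ha)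
    have h1 := hg a ha k hk hk0
    rw [hab] at hk0
    exact h1.symm.trans (hg b hb k hk hk0)
  have gsurj : Set.SurjOn g I I :=
    Finset.surjOn_of_injOn_of_card_le g (fun a ha => hgI a ha) ginj le_rfl
  refine ⟨fun i => if i ∈ I then 1 else 0, ?_, ?_⟩
  · obtain ⟨i, hi⟩ := hI.1
    intro h
    have := congrFun h i
    simp [hi] at this
  · intro i hi
    have hiI : i ∈ I := by
      by_contra h
      simp [h] at hi
    obtain ⟨j, hj, rfl⟩ := gsurj hiI
    obtain ⟨k, hk, hk0⟩ := hI.2 (g j) hiI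
    have hkj := hg j hj k hk hk0
    subst hkj
    rw [Finset.sum_eq_single k]
    · simpa [hk] using hk0
    · intro b _ hb
      by_cases hbI : b ∈ I
      · have : Φ (g k) b = 0 := by
          by_contra h
          exact hb (hg k hj b hbI h)
        simp [this]
      · simp [hbI]
    · simp

/-- A trivial spectrum space contains, for some `i`, no nonzero matrix supported on row `i`. -/
lemma exists_row {K : Type*} [Field K] {n : ℕ}
    (S : Submodule K (Matrix (Fin (n+1)) (Fin (n+1)) K))
    (h : ∀ B ∈ S, ∀ v, B *ᵥ v = v → v = 0) :
    ∃ i, ∀ B ∈ S, (∀ k, k ≠ i → ∀ j, B k j = 0) → B = 0 := by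
  classical
  by_contra hcon
  push Not at hcon
  choose B hBS hB hB0 using hcon
  obtain ⟨v, hv0, hv⟩ := exists_good_vec (fun i j => B i i j) (by
    intro i
    by_contra hc
    push Not at hc
    apply hB0 i
    ext k j
    by_cases hk : k = i
    · subst hk; simpa using hc j
    · simpa using hB i k hk j)
  apply hv0
  refine h (∑ i, (v i / ∑ j, B i i j * v j) • B i)
    (Submodule.sum_mem _ fun i _ => S.smul_mem _ (hBS i)) v ?_
  rw [Matrix.sum_mulVec]
  ext k
  rw [Finset.sum_apply, Finset.sum_eq_single k]
  · by_cases hk : v k = 0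
    · simp [hk]
    · rw [Matrix.smul_mulVec, Pi.smul_apply, smul_eq_mul]
      simp only [Matrix.mulVec, dotProduct]
      exact div_mul_cancel₀ _ (hv k hk)
  · intro b _ hb
    rw [Matrix.smul_mulVec, Pi.smul_apply, smul_eq_mul]
    simp [Matrix.mulVec, dotProduct, hB b k hb.symm]
  · simp

/-- Rank-nullity for the restriction of a linear map to a subspace. -/
lemma finrank_map_add_inf {K V W : Type*} [Field K] [AddCommGroup V] [Module K V]
    [FiniteDimensional K V] [AddCommGroup W] [Module K W]
    (S : Submodule K V) (L : V →ₗ[K] W) :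
    Module.finrank K (S.map L) + Module.finrank K (S ⊓ LinearMap.ker L : Submodule K V) =
      Module.finrank K S := by
  have := LinearMap.finrank_range_add_finrank_ker (L.domRestrict S)
  rw [LinearMap.range_domRestrict] at this
  rw [← this, LinearMap.ker_domRestrict, ← Submodule.finrank_map_subtype_eq,
    Submodule.map_comap_subtype]

lemma finrank_map_of_inj {K V W : Type*} [Field K] [AddCommGroup V] [Module K V]
    [FiniteDimensional K V] [AddCommGroup W] [Module K W]
    (S : Submodule K V) (L : V →ₗ[K] W) (h : ∀ x ∈ S, L x = 0 → x = 0) :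
    Module.finrank K (S.map L) = Module.finrank K S := by
  have h0 : S ⊓ LinearMap.ker L = ⊥ := by
    rw [eq_bot_iff]
    rintro x ⟨hx, hx'⟩
    exact h x hx hx'
  have := finrank_map_add_inf S L
  rw [h0, finrank_bot] at this
  simpa using this

lemma trivial_spectrum {K : Type*} [Field K] : ∀ (n : ℕ)
    (S : Submodule K (Matrix (Fin n) (Fin n) K))
    (_ : ∀ B ∈ S, ∀ v, B *ᵥ v = v → v = 0),
    2 * Module.finrank K S + n ≤ n * n := by
  classical
  intro n
  induction n with
  | zero =>
    intro S _
    have h0 := Submodule.finrank_le S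
    rw [Module.finrank_matrix] at h0
    simp only [Fintype.card_fin, zero_mul] at h0
    omega
  | succ n ih =>
    intro S h
    obtain ⟨i, hi⟩ := exists_row S h
    let L1 : Matrix (Fin (n+1)) (Fin (n+1)) K →ₗ[K] (Fin (n+1) → K) :=
      { toFun := fun B k => B k i
        map_add' := fun _ _ => rfl
        map_smul' := fun _ _ => rfl }
    let L2 : Matrix (Fin (n+1)) (Fin (n+1)) K →ₗ[K] Matrix (Fin n) (Fin n) K :=
      { toFun := fun B => B.submatrix i.succAbove i.succAbove
        map_add' := fun _ _ => rfl
        map_smul' := fun _ _ => rfl }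
    have hr1 : Module.finrank K (S.map L1) < n + 1 := by
      have hne : S.map L1 ≠ ⊤ := by
        intro htop
        have hm : (Pi.single i 1 : Fin (n+1) → K) ∈ S.map L1 := by rw [htop]; trivial
        obtain ⟨B, hB, hBi⟩ := hm
        have h0 := h B hB (Pi.single i 1) (by
          rw [Matrix.mulVec_single_one]
          exact hBi)
        have := congrFun h0 i
        simp at this
      have := Submodule.finrank_lt hne
      simpa using this
    have hr2 := ih ((S ⊓ LinearMap.ker L1).map L2) (by
      rintro _ ⟨B, ⟨hB, hBk⟩, rfl⟩ w hw
      have hcol : ∀ k, B k i = 0 := fun k => congrFun (LinearMap.mem_ker.1 hBk) k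
      have hv := h B hB (i.insertNth (∑ j, B i (i.succAbove j) * w j) w) (by
        ext k
        simp only [Matrix.mulVec, dotProduct]
        rw [Fin.sum_univ_succAbove _ i]
        simp only [hcol, Fin.insertNth_apply_same, Fin.insertNth_apply_succAbove, zero_mul,
          zero_add]
        refine Fin.succAboveCases i ?_ ?_ k
        · simp
        · intro l
          have := congrFun hw l
          change ∑ j, B (i.succAbove l) (i.succAbove j) * w j = w l at this
          simpa [ Matrix.mulVec, dotProduct] using this)
      ext j
      have := congrFun hv (i.succAbove j)
      simpa using this)
    have hinj : Module.finrank K ((S ⊓ LinearMap.ker L1).map L2) =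
        Module.finrank K (S ⊓ LinearMap.ker L1 : Submodule K _) := by
      refine finrank_map_of_inj _ _ ?_
      rintro B ⟨hB, hBk⟩ hB2
      refine hi B hB ?_
      intro k hk j
      obtain ⟨k, rfl⟩ := Fin.exists_succAbove_eq hk
      by_cases hj : j = i
      · subst hj
        exact congrFun (LinearMap.mem_ker.1 hBk) _
      · obtain ⟨j, rfl⟩ := Fin.exists_succAbove_eq hj
        exact congrFun (congrFun hB2 k) j
    have hsum := finrank_map_add_inf S L1
    rw [hinj] at hr2
    nlinarith

lemma col_step {K : Type*} [Field K] {n q r : ℕ}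
    (ih : ∀ (A : Matrix (Fin n) (Fin q) K) (S : Submodule K (Matrix (Fin n) (Fin q) K)),
      (∀ B ∈ S, r ≤ (A + B).rank) → Module.finrank K S + r * (r + 1) / 2 ≤ n * q)
    (A : Matrix (Fin n) (Fin (q+1)) K)
    (S : Submodule K (Matrix (Fin n) (Fin (q+1)) K))
    (h : ∀ B ∈ S, r ≤ (A + B).rank)
    (B₀ : Matrix (Fin n) (Fin (q+1)) K) (hB₀ : B₀ ∈ S) (v : Fin (q+1) → K) (hv : v ≠ 0)
    (hv0 : (A + B₀) *ᵥ v = 0) :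
    Module.finrank K S + r * (r + 1) / 2 ≤ n * (q+1) := by
  classical
  obtain ⟨i, hi⟩ : ∃ i, v i ≠ 0 := by
    by_contra hc
    push Not at hc
    exact hv (funext hc)
  let L1 : Matrix (Fin n) (Fin (q+1)) K →ₗ[K] (Fin n → K) :=
    { toFun := fun B => B *ᵥ v
      map_add' := fun _ _ => Matrix.add_mulVec _ _ _
      map_smul' := fun _ _ => Matrix.smul_mulVec _ _ _ }
  let L2 : Matrix (Fin n) (Fin (q+1)) K →ₗ[K] Matrix (Fin n) (Fin q) K :=
    { toFun := fun B => B.submatrix id i.succAbove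
      map_add' := fun _ _ => rfl
      map_smul' := fun _ _ => rfl }
  -- for matrices killing `v`, column `i` is determined by the others
  have hcol : ∀ M : Matrix (Fin n) (Fin (q+1)) K, M *ᵥ v = 0 →
      ∀ k, M k i = ∑ j, M k (i.succAbove j) * (-(v (i.succAbove j) / v i)) := by
    intro M hM k
    have h0 := congrFun hM k
    simp only [Matrix.mulVec, dotProduct] at h0
    rw [Fin.sum_univ_succAbove _ i] at h0
    have h2 : M k i = -(∑ j, M k (i.succAbove j) * v (i.succAbove j)) / v i := by
      rw [eq_div_iff hi]
      exact eq_neg_of_add_eq_zero_left h0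
    rw [h2, neg_div, Finset.sum_div, ← Finset.sum_neg_distrib]
    refine Finset.sum_congr rfl fun j _ => ?_
    ring
  have hr1 : Module.finrank K (S.map L1) ≤ n := by
    simpa using Submodule.finrank_le (S.map L1)
  have hr2 := ih (L2 (A + B₀)) ((S ⊓ LinearMap.ker L1).map L2) (by
    rintro _ ⟨B, ⟨hB, hBk⟩, rfl⟩
    rw [← map_add]
    have hMv : (A + B₀ + B) *ᵥ v = 0 := by
      have hB0 : B *ᵥ v = 0 := LinearMap.mem_ker.1 hBk
      rw [Matrix.add_mulVec, hv0, hB0, add_zero]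
    have hr := h (B₀ + B) (S.add_mem hB₀ hB)
    rw [← add_assoc] at hr
    generalize A + B₀ + B = M at hMv hr
    let P : Matrix (Fin q) (Fin (q+1)) K := fun k => i.insertNth (-(v (i.succAbove k) / v i))
      (fun j => if k = j then 1 else 0)
    have hMP : M = L2 M * P := by
      change M = M.submatrix id i.succAbove * P
      ext k j
      rw [Matrix.mul_apply]
      refine Fin.succAboveCases i ?_ ?_ j
      · simpa [P] using hcol M hMv k
      · intro l
        simp [P]
    rw [hMP] at hr
    exact hr.trans (Matrix.rank_mul_le_left _ _))
  have hinj : Module.finrank K ((S ⊓ LinearMap.ker L1).map L2) =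
      Module.finrank K (S ⊓ LinearMap.ker L1 : Submodule K _) := by
    refine finrank_map_of_inj _ _ ?_
    rintro B ⟨hB, hBk⟩ hB2
    have hz : ∀ k j, B k (i.succAbove j) = 0 := fun k j => congrFun (congrFun hB2 k) j
    ext k j
    refine Fin.succAboveCases i ?_ ?_ j
    · rw [hcol B (LinearMap.mem_ker.1 hBk) k]
      simp [hz]
    · intro l
      simpa using hz k l
  have hsum := finrank_map_add_inf S L1
  rw [hinj] at hr2
  have hq : n * (q + 1) = n * q + n := Nat.mul_succ n q
  generalize r * (r + 1) / 2 = c at hr2 ⊢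
  omega

lemma main_aux {K : Type*} [Field K] : ∀ (N n p r : ℕ) (_ : n + p = N)
    (A : Matrix (Fin n) (Fin p) K)
    (S : Submodule K (Matrix (Fin n) (Fin p) K))
    (_ : ∀ B ∈ S, r ≤ (A + B).rank),
    Module.finrank K S + r * (r + 1) / 2 ≤ n * p := by
  classical
  intro N
  induction N using Nat.strong_induction_on with
  | _ N IH =>
  intro n p r hN A S h
  by_cases h1 : ∃ B ∈ S, ∃ v, v ≠ 0 ∧ (A + B) *ᵥ v = 0
  · obtain ⟨B₀, hB₀, v, hv, hv0⟩ := h1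
    cases p with
    | zero => exact absurd (Subsingleton.elim _ _) hv
    | succ q =>
      exact col_step (fun A S => IH (n + q) (by omega) n q r rfl A S) A S h B₀ hB₀ v hv hv0
  by_cases h2 : ∃ B ∈ S, ∃ v, v ≠ 0 ∧ (A + B)ᵀ *ᵥ v = 0
  · obtain ⟨B₀, hB₀, v, hv, hv0⟩ := h2
    cases n with
    | zero => exact absurd (Subsingleton.elim _ _) hv
    | succ q =>
      let e := Matrix.transposeLinearEquiv (Fin (q+1)) (Fin p) K K
      have := col_step (fun A S => IH (p + q) (by omega) p q r rfl A S) Aᵀ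
        (S.map e.toLinearMap) (by
          rintro _ ⟨B, hB, rfl⟩
          have := h B hB
          rw [← Matrix.rank_transpose] at this
          simpa [e] using this) B₀ᵀ ⟨B₀, hB₀, by simp [e]⟩ v hv (by simpa using hv0)
      rw [LinearEquiv.finrank_map_eq e] at this
      linarith
  push Not at h1 h2
  have hA : ∀ v, A *ᵥ v = 0 → v = 0 := by
    intro v hv
    by_contra hv0
    exact h1 0 S.zero_mem v hv0 (by simpa using hv)
  have hAt : ∀ v, Aᵀ *ᵥ v = 0 → v = 0 := by
    intro v hv
    by_contra hv0
    exact h2 0 S.zero_mem v hv0 (by rwa [add_zero])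
  have inj1 : Function.Injective A.mulVecLin :=
    (injective_iff_map_eq_zero _).2 (fun v hv => hA v (by simpa using hv))
  have inj2 : Function.Injective Aᵀ.mulVecLin :=
    (injective_iff_map_eq_zero _).2 (fun v hv => hAt v hv)
  have e1 := LinearMap.finrank_le_finrank_of_injective inj1
  have e2 := LinearMap.finrank_le_finrank_of_injective inj2
  simp only [Module.finrank_fin_fun] at e1 e2
  obtain rfl : n = p := le_antisymm e2 e1
  have hu : IsUnit A := Matrix.mulVec_injective_iff_isUnit.1 inj1
  have hdet : IsUnit A.det := (Matrix.isUnit_iff_isUnit_det A).1 hu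
  let L : Matrix (Fin n) (Fin n) K →ₗ[K] Matrix (Fin n) (Fin n) K := LinearMap.mulLeft K A⁻¹
  have Linj : Function.Injective L := by
    intro X Y hXY
    have : A * (A⁻¹ * X) = A * (A⁻¹ * Y) := congrArg (A * ·) hXY
    simpa [Matrix.mul_nonsing_inv_cancel_left _ _ hdet] using this
  have hfin := trivial_spectrum n (S.map L) (by
    rintro _ ⟨B, hB, rfl⟩ v hv
    by_contra hv0
    refine h1 (-B) (S.neg_mem hB) v hv0 ?_
    have : A *ᵥ ((A⁻¹ * B) *ᵥ v) = A *ᵥ v := congrArg (A *ᵥ ·) hv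
    rw [Matrix.mulVec_mulVec, Matrix.mul_nonsing_inv_cancel_left _ _ hdet] at this
    rw [Matrix.add_mulVec, Matrix.neg_mulVec, this, add_neg_cancel])
  rw [finrank_map_of_inj S L (fun x _ hx => Linj (by rw [hx, map_zero]))] at hfin
  have hrn : r ≤ n := by
    have := h 0 S.zero_mem
    exact this.trans (Matrix.rank_le_height _)
  have : r * (r+1) / 2 * 2 ≤ n * (n+1) :=
    (Nat.div_mul_le_self _ _).trans (Nat.mul_le_mul hrn (by omega))
  nlinarith

theorem stmt_5 {K : Type*} [Field K] {n p r : ℕ}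
    (hr : 1 ≤ r) (hrn : r ≤ n) (hrp : r ≤ p)
    (A : Matrix (Fin n) (Fin p) K)
    (S : Submodule K (Matrix (Fin n) (Fin p) K))
    (h : ∀ B ∈ S, r ≤ (A + B).rank) :
    Module.finrank K S + r * (r + 1) / 2 ≤ n * p :=
  main_aux (n + p) n p r rfl A S h
end
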